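/- Fix β > 1 and positive integers n ≥ 2, k, p, λ with m = pλ, and fix δ > 0 and ν > 0. Then there exist constants c, C, D > 0 depending only on β such that whenever m ≥ p ≥ c·k·(log⁴(n) + ν), the following holds with probability at least 1 − e^{−ν} on the draw of Φ: for every x ∈ ℝ^n with ‖Φx‖_∞ ≤ μ < 1 and every q ∈ ℂ^m satisfying Φx − q = Hu for some u ∈ ℂ^m with ‖u‖_∞ ≤ δ, every solution x̂ of the convex program min_{z∈ℂ^n} ‖z‖₁ subject to ‖V̂_β Φz − V̂_β q‖₂ ≤ δ·β^{−λ+1} satisfies ‖x̂ − x‖₂ ≤ C·β^{−m/p+1}·δ + D·σ_k(x)₁/√k. -/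

import Mathlib

open scoped BigOperators Matrix
noncomputable section

/-- The sign `±1` associated with a boolean. -/
def rsign (b : Bool) : ℝ := if b then 1 else -1

/-- `ℓ¹` norm of a real vector. -/
def norm1 {n : ℕ} (x : Fin n → ℝ) : ℝ := ∑ j, |x j|

/-- `ℓ¹` norm of a complex vector. -/
def norm1C {n : ℕ} (x : Fin n → ℂ) : ℝ := ∑ j, ‖x j‖

/-- Euclidean norm of a real vector. -/
def norm2 {n : ℕ} (x : Fin n → ℝ) : ℝ := Real.sqrt (∑ j, (x j) ^ 2)

/-- Euclidean norm of a complex vector. -/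
def norm2C {n : ℕ} (x : Fin n → ℂ) : ℝ := Real.sqrt (∑ j, ‖x j‖ ^ 2)

/-- `ℓ∞` norm of a complex vector. -/
def normInfC {n : ℕ} (x : Fin n → ℂ) : ℝ := ⨆ j, ‖x j‖

/-- Block-diagonal matrix `I_p ⊗ v` with `p` copies of the row vector `v` on the diagonal. -/
def kronRow (p : ℕ) {lam : ℕ} (v : Fin lam → ℝ) : Matrix (Fin p) (Fin (p * lam)) ℝ :=
  Matrix.of fun i j =>
    if (j : ℕ) / lam = (i : ℕ) then
      (if h2 : (j : ℕ) % lam < lam then v ⟨(j : ℕ) % lam, h2⟩ else 0)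
    else 0

/-- Block-diagonal matrix `I_p ⊗ B` with `p` copies of the square matrix `B` on the diagonal. -/
def kronDiag (p : ℕ) {lam : ℕ} (B : Matrix (Fin lam) (Fin lam) ℝ) :
    Matrix (Fin (p * lam)) (Fin (p * lam)) ℝ :=
  Matrix.of fun i j =>
    if (i : ℕ) / lam = (j : ℕ) / lam then
      (if h1 : (i : ℕ) % lam < lam then
        (if h2 : (j : ℕ) % lam < lam then B ⟨(i : ℕ) % lam, h1⟩ ⟨(j : ℕ) % lam, h2⟩ else 0)
       else 0)
    else 0

/-- The vector `v_β = (β^{-1}, …, β^{-λ})`. -/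
def betaVec (β : ℝ) (lam : ℕ) : Fin lam → ℝ := fun j => β ^ (-((j : ℕ) : ℤ) - 1)

/-- The `λ×λ` noise transfer matrix `H_β`: ones on the diagonal, `-β` on the subdiagonal. -/
def betaH (β : ℝ) (lam : ℕ) : Matrix (Fin lam) (Fin lam) ℝ :=
  Matrix.of fun i j =>
    if (i : ℕ) = (j : ℕ) then 1 else if (i : ℕ) = (j : ℕ) + 1 then -β else 0

/-- The best `k`-term approximation error `σ_k(x)₁ = min {‖x − w‖₁ : w is k-sparse}`. -/
def sigmaK {n : ℕ} (k : ℕ) (x : Fin n → ℝ) : ℝ :=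
  sInf {c : ℝ | ∃ w : Fin n → ℝ,
    (∃ s : Finset (Fin n), s.card ≤ k ∧ ∀ t ∉ s, w t = 0) ∧ c = norm1 (x - w)}

/-- Probability of an event under the uniform distribution on a finite sample space. -/
def unifProb {Ω : Type*} [Fintype Ω] (P : Ω → Prop) : ℝ :=
  (Nat.card {ω : Ω // P ω} : ℝ) / (Fintype.card Ω : ℝ)

/-! ### The uniform probability on a finite type -/

section UnifProb

open scoped Classical in
theorem unifProb_eq_sum {Ω : Type*} [Fintype Ω] (P : Ω → Prop) :
    unifProb P = (∑ ω, if P ω then (1 : ℝ) else 0) / Fintype.card Ω := by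
  rw [unifProb, Nat.card_eq_fintype_card, Fintype.card_subtype, Finset.sum_boole]

theorem unifProb_nonneg {Ω : Type*} [Fintype Ω] (P : Ω → Prop) : 0 ≤ unifProb P := by
  unfold unifProb; positivity

theorem unifProb_mono {Ω : Type*} [Fintype Ω] {P Q : Ω → Prop} (h : ∀ ω, P ω → Q ω) :
    unifProb P ≤ unifProb Q := by
  classical
  rw [unifProb_eq_sum, unifProb_eq_sum]
  gcongr with ω
  by_cases hP : P ω
  · simp [hP, h ω hP]
  · simp only [hP, if_false]; split_ifs <;> norm_num

theorem unifProb_or_le {Ω : Type*} [Fintype Ω] (P Q : Ω → Prop) :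
    unifProb (fun ω => P ω ∨ Q ω) ≤ unifProb P + unifProb Q := by
  classical
  rw [unifProb_eq_sum, unifProb_eq_sum, unifProb_eq_sum, ← add_div, ← Finset.sum_add_distrib]
  gcongr with ω
  by_cases hP : P ω <;> by_cases hQ : Q ω <;> simp [hP, hQ]

theorem unifProb_exists_le {Ω ι : Type*} [Fintype Ω] (s : Finset ι) (P : ι → Ω → Prop) :
    unifProb (fun ω => ∃ j ∈ s, P j ω) ≤ ∑ j ∈ s, unifProb (P j) := by
  classical
  induction s using Finset.induction_on with
  | empty => simp [unifProb]
  | insert j s hj ih =>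
    rw [Finset.sum_insert hj]
    refine le_trans (unifProb_mono ?_) ((unifProb_or_le (P j) _).trans (add_le_add le_rfl ih))
    rintro ω ⟨i, hi, h⟩
    rcases Finset.mem_insert.1 hi with rfl | hi
    · exact Or.inl h
    · exact Or.inr ⟨i, hi, h⟩

theorem unifProb_not {Ω : Type*} [Fintype Ω] [Nonempty Ω] (P : Ω → Prop) :
    unifProb (fun ω => ¬ P ω) = 1 - unifProb P := by
  classical
  have hc : (Fintype.card Ω : ℝ) ≠ 0 := by exact_mod_cast Fintype.card_ne_zero
  rw [unifProb_eq_sum, unifProb_eq_sum, eq_sub_iff_add_eq, ← add_div, ← Finset.sum_add_distrib,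
    div_eq_one_iff_eq hc]
  calc _ = ∑ _ω : Ω, (1 : ℝ) := by
        refine Finset.sum_congr rfl fun ω _ => ?_
        by_cases h : P ω <;> simp [h]
    _ = _ := by simp

open scoped Classical in
/-- Exchanging a weighted sum of probabilities with the uniform average. -/
theorem sum_mul_unifProb_le {Ω G : Type*} [Fintype Ω] [Nonempty Ω] [Fintype G] (w : G → ℝ)
    (B : G → Ω → Prop) {c : ℝ} (h : ∀ ω, ∑ g, w g * (if B g ω then (1 : ℝ) else 0) ≤ c) :
    ∑ g, w g * unifProb (B g) ≤ c := by
  have hW : (0 : ℝ) < Fintype.card Ω := by exact_mod_cast Fintype.card_pos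
  simp only [unifProb_eq_sum, mul_div_assoc', Finset.mul_sum]
  rw [← Finset.sum_div, Finset.sum_comm, div_le_iff₀ hW]
  calc _ ≤ ∑ _ω : Ω, c := Finset.sum_le_sum fun ω _ => h ω
    _ = _ := by simp [mul_comm]

theorem unifProb_congr_equiv {Ω Ω' : Type*} [Fintype Ω] [Fintype Ω'] (e : Ω ≃ Ω')
    (P : Ω' → Prop) : unifProb (fun ω => P (e ω)) = unifProb P := by
  unfold unifProb
  rw [Fintype.card_congr e, Nat.card_congr (e.subtypeEquiv (p := fun ω => P (e ω)) (q := P)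
    (fun _ => Iff.rfl))]

end UnifProb

/-! ### Exponential tail bounds -/

section Tails

/-- Hoeffding's inequality for `N` independent draws from a finitely supported distribution. -/
theorem weighted_hoeffding {ι : Type*} [Fintype ι] (q Y : ι → ℝ) {R τ : ℝ} (N : ℕ)
    (hq : ∀ r, 0 ≤ q r) (hq1 : ∑ r, q r = 1) (hY : ∑ r, q r * Y r = 0) (hR : 0 < R)
    (hYR : ∀ r, |Y r| ≤ R) (hτ : 0 ≤ τ) (hτR : τ ≤ 2 * R) :
    ∑ r : Fin N → ι, (∏ i, q (r i)) * (if N * τ ≤ ∑ i, Y (r i) then (1 : ℝ) else 0)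
      ≤ Real.exp (-(N * (τ ^ 2 / (4 * R ^ 2)))) := by
  set θ := τ / (2 * R ^ 2) with hθ
  have hθ0 : 0 ≤ θ := by positivity
  have hθR : θ * R ≤ 1 := by
    rw [hθ, div_mul_eq_mul_div, div_le_one (by positivity)]; nlinarith
  have hmgf : ∑ r, q r * Real.exp (θ * Y r) ≤ Real.exp (θ ^ 2 * R ^ 2) := by
    have hterm : ∀ r, q r * Real.exp (θ * Y r) ≤
        q r + θ * (q r * Y r) + q r * (θ ^ 2 * R ^ 2) := by
      intro r
      have habs : |θ * Y r| ≤ 1 := by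
        rw [abs_mul, abs_of_nonneg hθ0]
        exact (mul_le_mul_of_nonneg_left (hYR r) hθ0).trans hθR
      have h1 := (abs_le.1 (Real.abs_exp_sub_one_sub_id_le habs)).2
      have h2 : (θ * Y r) ^ 2 ≤ θ ^ 2 * R ^ 2 := by
        rw [mul_pow, ← sq_abs (Y r)]
        gcongr
        exact hYR r
      have h3 : Real.exp (θ * Y r) ≤ 1 + θ * Y r + θ ^ 2 * R ^ 2 := by linarith
      calc _ ≤ q r * (1 + θ * Y r + θ ^ 2 * R ^ 2) := mul_le_mul_of_nonneg_left h3 (hq r)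
        _ = _ := by ring
    calc _ ≤ ∑ r, (q r + θ * (q r * Y r) + q r * (θ ^ 2 * R ^ 2)) :=
          Finset.sum_le_sum fun r _ => hterm r
      _ = 1 + θ ^ 2 * R ^ 2 := by
          rw [Finset.sum_add_distrib, Finset.sum_add_distrib, ← Finset.mul_sum, ← Finset.sum_mul,
            hq1, hY]; ring
      _ ≤ _ := by linarith [Real.add_one_le_exp (θ ^ 2 * R ^ 2)]
  have hterm : ∀ r : Fin N → ι,
      (∏ i, q (r i)) * (if N * τ ≤ ∑ i, Y (r i) then (1 : ℝ) else 0) ≤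
        Real.exp (-(θ * (N * τ))) * ∏ i, (q (r i) * Real.exp (θ * Y (r i))) := by
    intro r
    have hprod : 0 ≤ ∏ i, q (r i) := Finset.prod_nonneg fun i _ => hq _
    have hind : (if N * τ ≤ ∑ i, Y (r i) then (1 : ℝ) else 0) ≤
        Real.exp (-(θ * (N * τ)) + θ * ∑ i, Y (r i)) := by
      split_ifs with h
      · apply Real.one_le_exp
        nlinarith [mul_le_mul_of_nonneg_left h hθ0]
      · positivity
    calc _ ≤ (∏ i, q (r i)) * Real.exp (-(θ * (N * τ)) + θ * ∑ i, Y (r i)) :=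
          mul_le_mul_of_nonneg_left hind hprod
      _ = _ := by
          rw [Finset.prod_mul_distrib, ← Real.exp_sum, ← Finset.mul_sum, Real.exp_add]; ring
  calc _ ≤ ∑ r : Fin N → ι,
        Real.exp (-(θ * (N * τ))) * ∏ i, (q (r i) * Real.exp (θ * Y (r i))) :=
        Finset.sum_le_sum fun r _ => hterm r
    _ = Real.exp (-(θ * (N * τ))) * (∑ r, q r * Real.exp (θ * Y r)) ^ N := by
        rw [← Finset.mul_sum, Fintype.sum_pow]
    _ ≤ Real.exp (-(θ * (N * τ))) * Real.exp (θ ^ 2 * R ^ 2) ^ N := by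
        gcongr
        exact Finset.sum_nonneg fun r _ => mul_nonneg (hq r) (Real.exp_nonneg _)
    _ = _ := by
        rw [← Real.exp_nat_mul, ← Real.exp_add]
        congr 1
        rw [hθ]
        field_simp
        ring

/-- Complex version of `weighted_hoeffding`. -/
theorem weighted_hoeffding_complex {ι : Type*} [Fintype ι] (q : ι → ℝ) (Z : ι → ℂ) {R τ : ℝ}
    (N : ℕ) (hq : ∀ r, 0 ≤ q r) (hq1 : ∑ r, q r = 1) (hZ : ∑ r, (q r : ℂ) * Z r = 0) (hR : 0 < R)
    (hZR : ∀ r, ‖Z r‖ ≤ R) (hτ : 0 ≤ τ) (hτR : τ ≤ 4 * R) :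
    ∑ r : Fin N → ι, (∏ i, q (r i)) * (if N * τ < ‖∑ i, Z (r i)‖ then (1 : ℝ) else 0)
      ≤ 4 * Real.exp (-(N * (τ ^ 2 / (16 * R ^ 2)))) := by
  have hre : ∑ r, q r * (Z r).re = 0 := by
    simpa using congrArg Complex.re hZ
  have him : ∑ r, q r * (Z r).im = 0 := by
    simpa using congrArg Complex.im hZ
  have hbr : ∀ r, |(Z r).re| ≤ R := fun r => (Complex.abs_re_le_norm _).trans (hZR r)
  have hbi : ∀ r, |(Z r).im| ≤ R := fun r => (Complex.abs_im_le_norm _).trans (hZR r)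
  have key : ∀ Y : ι → ℝ, ∑ r, q r * Y r = 0 → (∀ r, |Y r| ≤ R) →
      ∑ r : Fin N → ι, (∏ i, q (r i)) * (if N * (τ / 2) ≤ ∑ i, Y (r i) then (1 : ℝ) else 0)
        ≤ Real.exp (-(N * (τ ^ 2 / (16 * R ^ 2)))) := by
    intro Y hY hYR
    refine (weighted_hoeffding q Y N hq hq1 hY hR hYR (by positivity : 0 ≤ τ / 2)
      (by linarith)).trans_eq ?_
    congr 3
    ring
  have e1 := key (fun r => (Z r).re) hre hbr
  have e2 := key (fun r => -(Z r).re) (by simp [hre]) (by simpa using hbr)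
  have e3 := key (fun r => (Z r).im) him hbi
  have e4 := key (fun r => -(Z r).im) (by simp [him]) (by simpa using hbi)
  have hterm : ∀ r : Fin N → ι,
      (∏ i, q (r i)) * (if N * τ < ‖∑ i, Z (r i)‖ then (1 : ℝ) else 0) ≤
      (∏ i, q (r i)) * (if N * (τ / 2) ≤ ∑ i, (Z (r i)).re then (1 : ℝ) else 0) +
      (∏ i, q (r i)) * (if N * (τ / 2) ≤ ∑ i, -(Z (r i)).re then (1 : ℝ) else 0) +
      (∏ i, q (r i)) * (if N * (τ / 2) ≤ ∑ i, (Z (r i)).im then (1 : ℝ) else 0) +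
      (∏ i, q (r i)) * (if N * (τ / 2) ≤ ∑ i, -(Z (r i)).im then (1 : ℝ) else 0) := by
    intro r
    rw [← mul_add, ← mul_add, ← mul_add]
    refine mul_le_mul_of_nonneg_left ?_ (Finset.prod_nonneg fun i _ => hq _)
    have hpos : ∀ P : Prop, ∀ _ : Decidable P, (0 : ℝ) ≤ if P then (1 : ℝ) else 0 := by
      intro P _; split_ifs <;> norm_num
    have h1 := hpos (N * (τ / 2) ≤ ∑ i, (Z (r i)).re) inferInstance
    have h2 := hpos (N * (τ / 2) ≤ ∑ i, -(Z (r i)).re) inferInstance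
    have h3 := hpos (N * (τ / 2) ≤ ∑ i, (Z (r i)).im) inferInstance
    have h4 := hpos (N * (τ / 2) ≤ ∑ i, -(Z (r i)).im) inferInstance
    by_cases h : N * τ < ‖∑ i, Z (r i)‖
    · rw [if_pos h]
      have hn := h.trans_le (Complex.norm_le_abs_re_add_abs_im _)
      rw [Complex.re_sum, Complex.im_sum] at hn
      by_contra! hlt
      have n1 : ¬ N * (τ / 2) ≤ ∑ i, (Z (r i)).re := by
        intro hh; rw [if_pos hh] at hlt; linarith
      have n2 : ¬ N * (τ / 2) ≤ ∑ i, -(Z (r i)).re := by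
        intro hh; rw [if_pos hh] at hlt; linarith
      have n3 : ¬ N * (τ / 2) ≤ ∑ i, (Z (r i)).im := by
        intro hh; rw [if_pos hh] at hlt; linarith
      have n4 : ¬ N * (τ / 2) ≤ ∑ i, -(Z (r i)).im := by
        intro hh; rw [if_pos hh] at hlt; linarith
      rw [Finset.sum_neg_distrib] at n2 n4
      push Not at n1 n2 n3 n4
      have a1 : |∑ i, (Z (r i)).re| < N * (τ / 2) := abs_lt.2 ⟨by linarith, n1⟩
      have a2 : |∑ i, (Z (r i)).im| < N * (τ / 2) := abs_lt.2 ⟨by linarith, n3⟩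
      linarith
    · rw [if_neg h]; linarith
  refine (Finset.sum_le_sum fun r _ => hterm r).trans ?_
  rw [Finset.sum_add_distrib, Finset.sum_add_distrib, Finset.sum_add_distrib]
  linarith

/-- One-sided Chernoff bound for empirical frequencies. -/
theorem unifProb_empirical_lt {X : Type*} [Fintype X] [Nonempty X] {p : ℕ} (hp : 0 < p)
    (A : X → Prop) (e : ℝ) :
    unifProb (fun ω : Fin p → X => unifProb (fun i => A (ω i)) < unifProb A / 2 - e)
      ≤ Real.exp (-(p * e)) := by
  classical
  have hc : (0 : ℝ) < Fintype.card X := by exact_mod_cast Fintype.card_pos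
  have hp' : (0 : ℝ) < p := by exact_mod_cast hp
  have hexp : Real.exp (-1) ≤ 1 / 2 := by
    have := Real.exp_one_gt_d9
    rw [Real.exp_neg, one_div]
    exact inv_anti₀ (by norm_num) (by linarith)
  set F : X → ℝ := fun x => if A x then 1 else 0 with hF
  have hsum : (∑ x, Real.exp (-F x)) / Fintype.card X ≤ Real.exp (-(unifProb A / 2)) := by
    have h1 : ∀ x, Real.exp (-F x) ≤ 1 - F x / 2 := by
      intro x
      by_cases h : A x
      · simp only [hF, h, if_true]; linarith
      · simp [hF, h]
    calc _ ≤ (∑ x, (1 - F x / 2)) / Fintype.card X := by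
          gcongr with x; exact h1 x
      _ = 1 - unifProb A / 2 := by
          rw [unifProb_eq_sum, Finset.sum_sub_distrib, ← Finset.sum_div]
          simp only [Finset.sum_const, Finset.card_univ, nsmul_eq_mul, mul_one]
          field_simp
          rfl
      _ ≤ _ := by linarith [Real.add_one_le_exp (-(unifProb A / 2))]
  rw [unifProb_eq_sum]
  have hterm : ∀ ω : Fin p → X,
      (if unifProb (fun i => A (ω i)) < unifProb A / 2 - e then (1 : ℝ) else 0) ≤
        Real.exp (p * (unifProb A / 2 - e)) * ∏ i, Real.exp (-F (ω i)) := by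
    intro ω
    rw [← Real.exp_sum, ← Real.exp_add, Finset.sum_neg_distrib]
    split_ifs with h
    · apply Real.one_le_exp
      rw [unifProb_eq_sum (fun i => A (ω i)), Fintype.card_fin, div_lt_iff₀ hp'] at h
      have : ∑ i, F (ω i) = ∑ i, if A (ω i) then (1 : ℝ) else 0 := rfl
      rw [this]
      linarith
    · positivity
  calc _ ≤ (∑ ω : Fin p → X, Real.exp (p * (unifProb A / 2 - e)) * ∏ i, Real.exp (-F (ω i))) /
          Fintype.card (Fin p → X) := by
        gcongr with ω; exact hterm ω
    _ = Real.exp (p * (unifProb A / 2 - e)) * ((∑ x, Real.exp (-F x)) / Fintype.card X) ^ p := by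
        rw [← Finset.mul_sum, div_pow, Fintype.sum_pow, mul_div_assoc]
        simp
    _ ≤ Real.exp (p * (unifProb A / 2 - e)) * Real.exp (-(unifProb A / 2)) ^ p := by
        gcongr
    _ = _ := by
        rw [← Real.exp_nat_mul, ← Real.exp_add]
        congr 1
        ring

end Tails

/-! ### Sparse approximation of vectors with small `ℓ¹` norm -/

section Maurey

/-- A vector of `ℓ¹` norm at most `S` is a convex combination of the vectors `2 S i ^ r e_t`. -/
theorem exists_maurey_weights {n : ℕ} (hn : 0 < n) (h : Fin n → ℂ) {S : ℝ} (hS : 0 < S)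
    (hh : norm1C h ≤ S) :
    ∃ q : Fin n × Fin 4 → ℝ, (∀ r, 0 ≤ q r) ∧ ∑ r, q r = 1 ∧
      ∀ b : Fin n → ℂ, ∑ r, (q r : ℂ) * (2 * S * Complex.I ^ (r.2 : ℕ) * b r.1)
        = ∑ t, b t * h t := by
  have hn' : (0 : ℝ) < n := by exact_mod_cast hn
  set T := ∑ t, (|(h t).re| + |(h t).im|) with hT
  set ρ := (1 - T / (2 * S)) / (4 * n) with hρ
  have hTS : T ≤ 2 * S := by
    calc T ≤ ∑ t, 2 * ‖h t‖ := by
          refine Finset.sum_le_sum fun t _ => ?_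
          linarith [Complex.abs_re_le_norm (h t), Complex.abs_im_le_norm (h t)]
      _ = 2 * norm1C h := by rw [norm1C, Finset.mul_sum]
      _ ≤ _ := by linarith
  have hρ0 : 0 ≤ ρ := by
    have : T / (2 * S) ≤ 1 := (div_le_one (by positivity)).2 hTS
    exact div_nonneg (by linarith) (by positivity)
  refine ⟨fun r => (![max (h r.1).re 0, max (h r.1).im 0, max (-(h r.1).re) 0,
    max (-(h r.1).im) 0] r.2) / (2 * S) + ρ, ?_, ?_, ?_⟩
  · rintro ⟨t, r⟩
    refine add_nonneg (div_nonneg ?_ (by positivity)) hρ0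
    fin_cases r <;> simp
  · rw [Fintype.sum_prod_type]
    have : ∀ t, ∑ r : Fin 4, ((![max (h t).re 0, max (h t).im 0, max (-(h t).re) 0,
        max (-(h t).im) 0] r) / (2 * S) + ρ) =
        (|(h t).re| + |(h t).im|) / (2 * S) + 4 * ρ := by
      intro t
      have hre := max_zero_add_max_neg_zero_eq_abs_self (h t).re
      have him := max_zero_add_max_neg_zero_eq_abs_self (h t).im
      rw [Fin.sum_univ_four, ← hre, ← him]
      generalize max (h t).re 0 = r1
      generalize max (-(h t).re) 0 = r2
      generalize max (h t).im 0 = i1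
      generalize max (-(h t).im) 0 = i2
      simp
      ring
    simp only [this]
    rw [Finset.sum_add_distrib, ← Finset.sum_div, ← hT]
    simp only [Finset.sum_const, Finset.card_univ, Fintype.card_fin, nsmul_eq_mul]
    rw [hρ]
    field_simp
    ring
  · intro b
    rw [Fintype.sum_prod_type]
    refine Finset.sum_congr rfl fun t _ => ?_
    have hSc : (S : ℂ) ≠ 0 := by exact_mod_cast hS.ne'
    have hre : ((max (h t).re 0 : ℝ) : ℂ) - ((max (-(h t).re) 0 : ℝ) : ℂ) = ((h t).re : ℂ) := by
      rw [← Complex.ofReal_sub, max_zero_sub_max_neg_zero_eq_self]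
    have him : ((max (h t).im 0 : ℝ) : ℂ) - ((max (-(h t).im) 0 : ℝ) : ℂ) = ((h t).im : ℂ) := by
      rw [← Complex.ofReal_sub, max_zero_sub_max_neg_zero_eq_self]
    have hI3 : Complex.I ^ 3 = -Complex.I := Complex.I_pow_three
    conv_rhs => rw [← Complex.re_add_im (h t), ← hre, ← him]
    rw [Fin.sum_univ_four]
    dsimp only
    generalize max (h t).re 0 = r1
    generalize max (-(h t).re) 0 = r2
    generalize max (h t).im 0 = i1
    generalize max (-(h t).im) 0 = i2
    simp [hI3]
    field_simp
    ring

/-- The pairing of `b` with the average of the vectors `2 S i ^ r e_t`, `(t, r)` in the list `g`. -/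
def netVal {n N : ℕ} (S : ℝ) (g : Fin N → Fin n × Fin 4) (b : Fin n → ℂ) : ℂ :=
  (∑ i, 2 * S * Complex.I ^ ((g i).2 : ℕ) * b (g i).1) / N

theorem norm_pairing_le {n : ℕ} {b h : Fin n → ℂ} {K : ℝ} (hb : ∀ t, ‖b t‖ ≤ K) :
    ‖∑ t, b t * h t‖ ≤ K * norm1C h := by
  refine (norm_sum_le _ _).trans ?_
  rw [norm1C, Finset.mul_sum]
  refine Finset.sum_le_sum fun t _ => ?_
  rw [norm_mul]
  exact mul_le_mul_of_nonneg_right (hb t) (norm_nonneg _)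

/-- Maurey's empirical method, uniformly good for two finite families of functionals. -/
theorem exists_netVal_close {n N : ℕ} (hn : 0 < n) (hN : 0 < N) {X Y : Type*} [Fintype X]
    [Nonempty X] [Fintype Y] [Nonempty Y] {a : X → Fin n → ℂ} {a' : Y → Fin n → ℂ} {K S τ : ℝ}
    (hK : 0 < K) (hS : 0 < S) (ha : ∀ x t, ‖a x t‖ ≤ K) (ha' : ∀ y t, ‖a' y t‖ ≤ K)
    {h : Fin n → ℂ} (hh : norm1C h ≤ S) (hτ : 0 ≤ τ) (hτS : τ ≤ K * S) :
    ∃ g : Fin N → Fin n × Fin 4,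
      unifProb (fun x => τ / 4 < ‖netVal S g (a x) - ∑ t, a x t * h t‖) +
      unifProb (fun y => τ / 4 < ‖netVal S g (a' y) - ∑ t, a' y t * h t‖) ≤
        8 * Real.exp (-(N * (τ ^ 2 / (4096 * (K * S) ^ 2)))) := by
  classical
  obtain ⟨q, hq, hq1, hqb⟩ := exists_maurey_weights hn h hS hh
  set E := Real.exp (-(N * (τ ^ 2 / (4096 * (K * S) ^ 2)))) with hE
  have hKS : 0 < K * S := mul_pos hK hS
  have hN' : (0 : ℝ) < N := by exact_mod_cast hN
  have point : ∀ b : Fin n → ℂ, (∀ t, ‖b t‖ ≤ K) →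
      ∑ g : Fin N → Fin n × Fin 4, (∏ i, q (g i)) *
        (if τ / 4 < ‖netVal S g b - ∑ t, b t * h t‖ then (1 : ℝ) else 0) ≤ 4 * E := by
    intro b hb
    have hpair : ‖∑ t, b t * h t‖ ≤ K * S :=
      (norm_pairing_le hb).trans (mul_le_mul_of_nonneg_left hh hK.le)
    have := weighted_hoeffding_complex q
      (fun r => 2 * S * Complex.I ^ (r.2 : ℕ) * b r.1 - ∑ t, b t * h t) (R := 4 * (K * S))
      (τ := τ / 4) N hq hq1
      (by
        simp only [mul_sub]
        rw [Finset.sum_sub_distrib, hqb, ← Finset.sum_mul, ← Complex.ofReal_sum, hq1]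
        simp)
      (by positivity)
      (by
        intro r
        refine (norm_sub_le _ _).trans ?_
        have : ‖2 * (S : ℂ) * Complex.I ^ (r.2 : ℕ) * b r.1‖ ≤ 2 * S * K := by
          simp only [norm_mul, norm_pow, Complex.norm_I, one_pow, mul_one, Complex.norm_real,
            Real.norm_eq_abs, abs_of_pos hS, Complex.norm_ofNat]
          exact mul_le_mul_of_nonneg_left (hb _) (by positivity)
        nlinarith)
      (by positivity) (by linarith)
    convert this using 3 with g
    · congr 1
      rw [eq_iff_iff, Finset.sum_sub_distrib]
      have : netVal S g b - ∑ t, b t * h t =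
          ((∑ i, 2 * (S : ℂ) * Complex.I ^ ((g i).2 : ℕ) * b (g i).1) -
            ∑ _i : Fin N, ∑ t, b t * h t) / (N : ℂ) := by
        have hNc : (N : ℂ) ≠ 0 := by exact_mod_cast hN.ne'
        rw [netVal]
        simp only [Finset.sum_const, Finset.card_univ, Fintype.card_fin, nsmul_eq_mul]
        field_simp
      rw [this, norm_div, Complex.norm_natCast, lt_div_iff₀ hN', mul_comm]
    · field_simp
      ring
  by_contra! hcon
  have hw : ∑ g : Fin N → Fin n × Fin 4, ∏ i, q (g i) = 1 := by
    rw [← Fintype.sum_pow, hq1, one_pow]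
  have hwnn : ∀ g : Fin N → Fin n × Fin 4, 0 ≤ ∏ i, q (g i) :=
    fun g => Finset.prod_nonneg fun i _ => hq _
  have hpos : ∃ g ∈ (Finset.univ : Finset (Fin N → Fin n × Fin 4)), 0 < ∏ i, q (g i) := by
    by_contra! hz
    linarith [Finset.sum_nonpos hz]
  have hlt : ∑ g : Fin N → Fin n × Fin 4, (∏ i, q (g i)) * (8 * E) <
      ∑ g : Fin N → Fin n × Fin 4, (∏ i, q (g i)) *
        (unifProb (fun x => τ / 4 < ‖netVal S g (a x) - ∑ t, a x t * h t‖) +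
         unifProb (fun y => τ / 4 < ‖netVal S g (a' y) - ∑ t, a' y t * h t‖)) := by
    obtain ⟨g, hg, hg0⟩ := hpos
    exact Finset.sum_lt_sum (fun g _ => mul_le_mul_of_nonneg_left (hcon g).le (hwnn g))
      ⟨g, hg, mul_lt_mul_of_pos_left (hcon g) hg0⟩
  rw [← Finset.sum_mul, hw] at hlt
  simp only [mul_add] at hlt
  rw [Finset.sum_add_distrib] at hlt
  linarith [sum_mul_unifProb_le (fun g : Fin N → Fin n × Fin 4 => ∏ i, q (g i))
      (fun g x => τ / 4 < ‖netVal S g (a x) - ∑ t, a x t * h t‖) fun x => by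
        convert point (a x) (ha x),
    sum_mul_unifProb_le (fun g : Fin N → Fin n × Fin 4 => ∏ i, q (g i))
      (fun g y => τ / 4 < ‖netVal S g (a' y) - ∑ t, a' y t * h t‖) fun y => by
        convert point (a' y) (ha' y)]

/-- At a fixed level, the empirical frequency of large pairings is bounded below by their
probability, simultaneously for all vectors of small `ℓ¹` norm. -/
theorem unifProb_level_fails_le {n N p : ℕ} (hn : 0 < n) (hN : 0 < N) (hp : 0 < p) {X : Type*}
    [Fintype X] [Nonempty X] {a : X → Fin n → ℂ} {K S τ e : ℝ} (hK : 0 < K) (hS : 0 < S)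
    (ha : ∀ x t, ‖a x t‖ ≤ K) (hτ : 0 ≤ τ) (hτS : τ ≤ K * S)
    (he : 16 * Real.exp (-(N * (τ ^ 2 / (4096 * (K * S) ^ 2)))) ≤ e) :
    unifProb (fun ω : Fin p → X => ¬ ∀ h : Fin n → ℂ, norm1C h ≤ S →
      unifProb (fun x => τ ≤ ‖∑ t, a x t * h t‖) / 2 - e ≤
        unifProb (fun i => τ / 2 ≤ ‖∑ t, a (ω i) t * h t‖)) ≤
      (4 * n) ^ N * Real.exp (-(p * (e / 2))) := by
  have : Nonempty (Fin p) := ⟨⟨0, hp⟩⟩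
  calc _ ≤ unifProb (fun ω : Fin p → X =>
          ∃ g ∈ (Finset.univ : Finset (Fin N → Fin n × Fin 4)),
            unifProb (fun i => 3 * τ / 4 ≤ ‖netVal S g (a (ω i))‖) <
              unifProb (fun x => 3 * τ / 4 ≤ ‖netVal S g (a x)‖) / 2 - e / 2) := by
        refine unifProb_mono fun ω hω => ?_
        by_contra! hcon
        refine hω fun h hh => ?_
        obtain ⟨g, hg⟩ := exists_netVal_close (N := N) hn hN (a := a) (a' := fun i => a (ω i))
          hK hS ha (fun i => ha (ω i)) hh hτ hτS
        have hg' := hcon g (Finset.mem_univ _)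
        have h1 : unifProb (fun i => 3 * τ / 4 ≤ ‖netVal S g (a (ω i))‖) ≤
            unifProb (fun i => τ / 2 ≤ ‖∑ t, a (ω i) t * h t‖) +
            unifProb (fun i => τ / 4 < ‖netVal S g (a (ω i)) - ∑ t, a (ω i) t * h t‖) := by
          refine (unifProb_mono fun i hi => ?_).trans (unifProb_or_le _ _)
          by_contra! hc
          linarith [norm_sub_norm_le (netVal S g (a (ω i))) (∑ t, a (ω i) t * h t)]
        have h2 : unifProb (fun x => τ ≤ ‖∑ t, a x t * h t‖) ≤
            unifProb (fun x => 3 * τ / 4 ≤ ‖netVal S g (a x)‖) +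
            unifProb (fun x => τ / 4 < ‖netVal S g (a x) - ∑ t, a x t * h t‖) := by
          refine (unifProb_mono fun x hx => ?_).trans (unifProb_or_le _ _)
          by_contra! hc
          have := norm_sub_norm_le (∑ t, a x t * h t) (netVal S g (a x))
          rw [norm_sub_rev] at this
          linarith
        have h3 := unifProb_nonneg (fun x => τ / 4 < ‖netVal S g (a x) - ∑ t, a x t * h t‖)
        linarith
    _ ≤ ∑ g : Fin N → Fin n × Fin 4, Real.exp (-(p * (e / 2))) :=
        (unifProb_exists_le _ _).trans
          (Finset.sum_le_sum fun g _ => unifProb_empirical_lt hp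
            (fun x => 3 * τ / 4 ≤ ‖netVal S g (a x)‖) (e / 2))
    _ = _ := by
        simp [mul_comm]

end Maurey

/-! ### Dyadic level decomposition -/

section Levels

theorem sq_le_sum_levels {B f : ℝ} (hf : 0 ≤ f) (hfB : f ≤ B) (J : ℕ) :
    f ^ 2 ≤ (B / 2 ^ J) ^ 2 + ∑ j ∈ Finset.range J,
      4 * (B / 2 ^ (j + 1)) ^ 2 * (if B / 2 ^ (j + 1) ≤ f then (1 : ℝ) else 0) := by
  induction J with
  | zero => simpa using pow_le_pow_left₀ hf hfB 2
  | succ J ih =>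
    rw [Finset.sum_range_succ]
    have hnn : 0 ≤ ∑ j ∈ Finset.range J,
        4 * (B / 2 ^ (j + 1)) ^ 2 * (if B / 2 ^ (j + 1) ≤ f then (1 : ℝ) else 0) :=
      Finset.sum_nonneg fun j _ => by split_ifs <;> positivity
    split_ifs with h
    · have : (B / 2 ^ J) ^ 2 = 4 * (B / 2 ^ (J + 1)) ^ 2 := by
        rw [pow_succ]; field_simp; ring
      nlinarith [sq_nonneg (B / 2 ^ (J + 1))]
    · have := pow_le_pow_left₀ hf (not_le.1 h).le 2
      linarith

theorem sum_levels_le_sq {B f : ℝ} (hB : 0 ≤ B) (hf : 0 ≤ f) (J : ℕ) :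
    ∑ j ∈ Finset.range J,
      (B / 2 ^ (j + 1)) ^ 2 * (if B / 2 ^ (j + 1) / 2 ≤ f then (1 : ℝ) else 0) ≤
        16 / 3 * f ^ 2 := by
  induction J generalizing B with
  | zero => simp; positivity
  | succ J ih =>
    by_cases h : B / 4 ≤ f
    · have hgeo : ∀ J : ℕ, ∑ j ∈ Finset.range J, (B / 2 ^ (j + 1)) ^ 2 ≤
          B ^ 2 / 3 - (B / 2 ^ J) ^ 2 / 3 := by
        intro J
        induction J with
        | zero => simp
        | succ J ih =>
          rw [Finset.sum_range_succ]
          have : (B / 2 ^ J) ^ 2 = 4 * (B / 2 ^ (J + 1)) ^ 2 := by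
            rw [pow_succ]; field_simp; ring
          linarith
      calc _ ≤ ∑ j ∈ Finset.range (J + 1), (B / 2 ^ (j + 1)) ^ 2 := by
            refine Finset.sum_le_sum fun j _ => ?_
            split_ifs
            · simp
            · simp; positivity
        _ ≤ B ^ 2 / 3 := by linarith [hgeo (J + 1), sq_nonneg (B / 2 ^ (J + 1))]
        _ ≤ _ := by nlinarith
    · rw [Finset.sum_range_succ']
      have h0 : ¬ B / 2 ^ (0 + 1) / 2 ≤ f := by
        rw [show B / 2 ^ (0 + 1) / 2 = B / 4 by ring]; exact h
      rw [if_neg h0, mul_zero, add_zero]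
      refine le_trans (le_of_eq (Finset.sum_congr rfl fun j _ => ?_)) (ih (B := B / 2) (by positivity))
      rw [show B / 2 ^ (j + 1 + 1) = B / 2 / 2 ^ (j + 1) by rw [pow_succ 2 (j + 1)]; field_simp]

/-- Comparison of second moments from a comparison of level-set probabilities. -/
theorem avg_sq_lower_bound {X Y : Type*} [Fintype X] [Nonempty X] [Fintype Y] [Nonempty Y]
    {F : X → ℝ} {G : Y → ℝ} {B : ℝ} {J : ℕ} {e : ℕ → ℝ} (hB : 0 ≤ B) (hF : ∀ x, 0 ≤ F x)
    (hFB : ∀ x, F x ≤ B) (hG : ∀ y, 0 ≤ G y) (hF1 : (∑ x, F x ^ 2) / Fintype.card X = 1)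
    (hJ : B / 2 ^ J ≤ 1 / 2)
    (he : ∑ j ∈ Finset.range J, (B / 2 ^ (j + 1)) ^ 2 * e j ≤ 1 / 64)
    (hlev : ∀ j ∈ Finset.range J, unifProb (fun x => B / 2 ^ (j + 1) ≤ F x) / 2 - e j ≤
      unifProb (fun y => B / 2 ^ (j + 1) / 2 ≤ G y)) :
    1 / 100 ≤ (∑ y, G y ^ 2) / Fintype.card Y := by
  classical
  have hX : (0 : ℝ) < Fintype.card X := by exact_mod_cast Fintype.card_pos
  have hY : (0 : ℝ) < Fintype.card Y := by exact_mod_cast Fintype.card_pos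
  have h1 : 1 ≤ (B / 2 ^ J) ^ 2 + ∑ j ∈ Finset.range J,
      4 * (B / 2 ^ (j + 1)) ^ 2 * unifProb (fun x => B / 2 ^ (j + 1) ≤ F x) := by
    have : ∑ x, F x ^ 2 ≤ ∑ x, ((B / 2 ^ J) ^ 2 + ∑ j ∈ Finset.range J,
        4 * (B / 2 ^ (j + 1)) ^ 2 * (if B / 2 ^ (j + 1) ≤ F x then (1 : ℝ) else 0)) :=
      Finset.sum_le_sum fun x _ => sq_le_sum_levels (hF x) (hFB x) J
    rw [← hF1, div_le_iff₀ hX]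
    refine this.trans_eq ?_
    rw [Finset.sum_add_distrib, Finset.sum_comm, add_mul, Finset.sum_mul]
    congr 1
    · simp [mul_comm]
    · refine Finset.sum_congr rfl fun j _ => ?_
      rw [unifProb_eq_sum, ← Finset.mul_sum]
      field_simp
  have h2 : ∑ j ∈ Finset.range J,
      (B / 2 ^ (j + 1)) ^ 2 * unifProb (fun y => B / 2 ^ (j + 1) / 2 ≤ G y) ≤
        16 / 3 * ((∑ y, G y ^ 2) / Fintype.card Y) := by
    have : ∑ y, ∑ j ∈ Finset.range J,
        (B / 2 ^ (j + 1)) ^ 2 * (if B / 2 ^ (j + 1) / 2 ≤ G y then (1 : ℝ) else 0) ≤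
          ∑ y, 16 / 3 * G y ^ 2 :=
      Finset.sum_le_sum fun y _ => sum_levels_le_sq hB (hG y) J
    rw [← Finset.mul_sum] at this
    rw [← mul_div_assoc, le_div_iff₀ hY]
    refine le_trans (le_of_eq ?_) this
    rw [Finset.sum_comm, Finset.sum_mul]
    refine Finset.sum_congr rfl fun j _ => ?_
    rw [unifProb_eq_sum, ← Finset.mul_sum]
    field_simp
  have h3 : ∑ j ∈ Finset.range J,
      (4 * (B / 2 ^ (j + 1)) ^ 2 * unifProb (fun x => B / 2 ^ (j + 1) ≤ F x) / 8 -
        (B / 2 ^ (j + 1)) ^ 2 * e j) ≤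
      ∑ j ∈ Finset.range J,
        (B / 2 ^ (j + 1)) ^ 2 * unifProb (fun y => B / 2 ^ (j + 1) / 2 ≤ G y) := by
    refine Finset.sum_le_sum fun j hj => ?_
    have := mul_le_mul_of_nonneg_left (hlev j hj) (sq_nonneg (B / 2 ^ (j + 1)))
    linarith
  rw [Finset.sum_sub_distrib, ← Finset.sum_div] at h3
  have h4 : (B / 2 ^ J) ^ 2 ≤ 1 / 4 := by
    calc _ ≤ (1 / 2 : ℝ) ^ 2 := pow_le_pow_left₀ (by positivity) hJ 2
      _ = _ := by norm_num
  linarith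

end Levels

/-! ### Restricted lower bound for bounded isotropic rows -/

section RestrictedLowerBound

theorem norm2C_sq {n : ℕ} (h : Fin n → ℂ) : norm2C h ^ 2 = ∑ t, ‖h t‖ ^ 2 :=
  Real.sq_sqrt (Finset.sum_nonneg fun _ _ => by positivity)

theorem norm2C_nonneg {n : ℕ} (h : Fin n → ℂ) : 0 ≤ norm2C h := Real.sqrt_nonneg _

theorem norm1C_le_sqrt_mul_norm2C {n : ℕ} (h : Fin n → ℂ) :
    norm1C h ≤ Real.sqrt n * norm2C h := by
  rw [norm2C, ← Real.sqrt_mul (by positivity)]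
  refine Real.le_sqrt_of_sq_le ?_
  have := sq_sum_le_card_mul_sum_sq (s := Finset.univ) (f := fun t => ‖h t‖)
  rwa [Finset.card_univ, Fintype.card_fin] at this

theorem norm1C_smul {n : ℕ} (r : ℝ) (h : Fin n → ℂ) :
    norm1C (fun t => (r : ℂ) * h t) = |r| * norm1C h := by
  simp [norm1C, Finset.mul_sum]

theorem sum_inv_mul_succ_le (J : ℕ) :
    ∑ j ∈ Finset.range J, 1 / (64 * (((j : ℝ) + 1) * (j + 2))) ≤ 1 / 64 := by
  have : ∀ J : ℕ, ∑ j ∈ Finset.range J, 1 / (64 * (((j : ℝ) + 1) * (j + 2))) =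
      1 / 64 - 1 / (64 * (J + 1)) := by
    intro J
    induction J with
    | zero => simp
    | succ J ih => rw [Finset.sum_range_succ, ih]; push_cast; field_simp; ring
  rw [this]
  have : (0 : ℝ) ≤ 1 / (64 * (J + 1)) := by positivity
  linarith

theorem mul_succ_le_four_pow (j : ℕ) : ((j : ℝ) + 1) * (j + 2) ≤ 4 ^ (j + 1) := by
  induction j with
  | zero => norm_num
  | succ j ih => rw [pow_succ]; push_cast; nlinarith [(Nat.cast_nonneg j : (0 : ℝ) ≤ j)]

theorem entropy_le_exponent {Λ Q m N l J b ν p : ℝ} (hΛ : 1 ≤ Λ) (hQ : 1 ≤ Q) (hm : 0 < m)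
    (hmQ : m ≤ Q) (hmΛ : m ≤ 16 * Λ ^ 2) (hN : N ≤ 4096 * Q * Λ + 1) (hl : 0 ≤ l) (hlΛ : l ≤ Λ)
    (hJ0 : 0 ≤ J) (hJ : J ≤ 3 * Λ) (hb : 0 < b) (hν : 0 ≤ ν)
    (hp : 128 * b * (2 ^ 18 * Λ ^ 4 + ν) ≤ p) :
    N * l + ν + J ≤ p * (Q / (64 * m * b) / 2) := by
  have hQΛ : 1 ≤ Q * Λ := by nlinarith
  have hNl : N * l ≤ 8192 * Q * Λ ^ 2 := by
    calc N * l ≤ (8192 * (Q * Λ)) * l := mul_le_mul_of_nonneg_right (by linarith) hl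
      _ ≤ (8192 * (Q * Λ)) * Λ := mul_le_mul_of_nonneg_left hlΛ (by positivity)
      _ = _ := by ring
  have h1 : m * (N * l) ≤ 2 ^ 17 * Q * Λ ^ 4 := by
    calc m * (N * l) ≤ m * (8192 * Q * Λ ^ 2) := mul_le_mul_of_nonneg_left hNl hm.le
      _ ≤ 16 * Λ ^ 2 * (8192 * Q * Λ ^ 2) := mul_le_mul_of_nonneg_right hmΛ (by positivity)
      _ = _ := by ring
  have h2 : m * J ≤ 3 * Q * Λ ^ 4 := by
    have hΛ4 : Λ ≤ Λ ^ 4 := le_self_pow₀ hΛ (by norm_num)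
    calc m * J ≤ Q * (3 * Λ ^ 4) := by
          apply mul_le_mul hmQ (by linarith) hJ0 (by linarith)
      _ = _ := by ring
  have h3 : m * ν ≤ Q * ν := mul_le_mul_of_nonneg_right hmQ hν
  have h4 : m * (N * l + ν + J) ≤ Q * (2 ^ 18 * Λ ^ 4 + ν) := by
    have : 0 ≤ Q * Λ ^ 4 := by positivity
    nlinarith
  have h5 : Q * (128 * b * (2 ^ 18 * Λ ^ 4 + ν)) ≤ Q * p :=
    mul_le_mul_of_nonneg_left hp (by linarith)
  have h6 : p * (Q / (64 * m * b) / 2) = Q * p / (128 * b * m) := by field_simp; ring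
  rw [h6, le_div_iff₀ (by positivity)]
  nlinarith

/-- Comparing all dyadic levels gives a lower bound for the empirical second moment. -/
theorem lower_bound_of_levels {X : Type*} [Fintype X] [Nonempty X] {n p J : ℕ} (hp : 0 < p)
    {a : X → Fin n → ℂ} {ω : Fin p → X} {K S : ℝ} {e : ℕ → ℝ} (hK0 : 0 < K) (hS0 : 0 < S)
    (ha : ∀ x t, ‖a x t‖ ≤ K)
    (hiso : ∀ h : Fin n → ℂ,
      (∑ x, ‖∑ t, a x t * h t‖ ^ 2) / Fintype.card X = ∑ t, ‖h t‖ ^ 2)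
    (hBJ : K * S / 2 ^ J ≤ 1 / 2)
    (he : ∑ j ∈ Finset.range J, (K * S / 2 ^ (j + 1)) ^ 2 * e j ≤ 1 / 64)
    (hcon : ∀ j ∈ Finset.range J, ∀ h : Fin n → ℂ, norm1C h ≤ S →
      unifProb (fun x => K * S / 2 ^ (j + 1) ≤ ‖∑ t, a x t * h t‖) / 2 - e j ≤
        unifProb (fun i => K * S / 2 ^ (j + 1) / 2 ≤ ‖∑ t, a (ω i) t * h t‖))
    {h : Fin n → ℂ} (hhS : norm1C h ≤ S * norm2C h) :
    1 / 100 * norm2C h ^ 2 ≤ (∑ i, ‖∑ t, a (ω i) t * h t‖ ^ 2) / p := by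
  have : Nonempty (Fin p) := ⟨⟨0, hp⟩⟩
  rcases (norm2C_nonneg h).eq_or_lt with h0 | hpos
  · rw [← h0]; simp; positivity
  set r := norm2C h with hr
  set g : Fin n → ℂ := fun t => ((r⁻¹ : ℝ) : ℂ) * h t with hg
  have hgS : norm1C g ≤ S := by
    rw [hg, norm1C_smul, abs_of_pos (inv_pos.2 hpos), inv_mul_le_iff₀ hpos, mul_comm]
    exact hhS
  have hpair : ∀ b : Fin n → ℂ,
      ‖∑ t, b t * g t‖ ^ 2 = (r⁻¹) ^ 2 * ‖∑ t, b t * h t‖ ^ 2 := by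
    intro b
    have : ∑ t, b t * g t = ((r⁻¹ : ℝ) : ℂ) * ∑ t, b t * h t := by
      rw [Finset.mul_sum]
      exact Finset.sum_congr rfl fun t _ => by rw [hg]; ring
    rw [this, norm_mul, mul_pow, Complex.norm_real, Real.norm_eq_abs, sq_abs]
  have hiso1 : (∑ x, ‖∑ t, a x t * g t‖ ^ 2) / Fintype.card X = 1 := by
    simp only [hpair]
    rw [← Finset.mul_sum, mul_div_assoc, hiso, ← norm2C_sq, ← hr, inv_pow]
    field_simp
  have hlow := avg_sq_lower_bound (F := fun x => ‖∑ t, a x t * g t‖)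
    (G := fun i => ‖∑ t, a (ω i) t * g t‖) (B := K * S) (J := J) (e := e) (by positivity)
    (fun x => norm_nonneg _)
    (fun x => (norm_pairing_le (ha x)).trans (mul_le_mul_of_nonneg_left hgS hK0.le))
    (fun i => norm_nonneg _) hiso1 hBJ
    he
    (fun j hj => hcon j hj g hgS)
  simp only [hpair] at hlow
  rw [← Finset.mul_sum, mul_div_assoc, inv_pow, Fintype.card_fin,
    ← div_eq_inv_mul, le_div_iff₀ (by positivity)] at hlow
  exact hlow

set_option maxHeartbeats 1000000 in
/-- Independent bounded isotropic rows satisfy a lower bound on the cone of effectively sparse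
vectors, with exponentially small failure probability. -/
theorem restricted_lower_bound {K : ℝ} (hK : 1 ≤ K) :
    ∃ c : ℝ, 0 < c ∧ ∀ {X : Type} [Fintype X] [Nonempty X] (n k p : ℕ) (ν : ℝ)
      (a : X → Fin n → ℂ), 2 ≤ n → 0 < k → 0 < p → 0 < ν → (∀ x t, ‖a x t‖ ≤ K) →
      (∀ h : Fin n → ℂ, (∑ x, ‖∑ t, a x t * h t‖ ^ 2) / Fintype.card X = ∑ t, ‖h t‖ ^ 2) →
      c * k * (Real.log n ^ 4 + ν) ≤ p →
      1 - Real.exp (-ν) ≤ unifProb (fun ω : Fin p → X => ∀ h : Fin n → ℂ,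
        norm1C h ≤ 4 * Real.sqrt k * norm2C h →
        1 / 100 * norm2C h ^ 2 ≤ (∑ i, ‖∑ t, a (ω i) t * h t‖ ^ 2) / p) := by
  have hK0 : 0 < K := by linarith
  have hlogK : 0 ≤ Real.log (1024 * K ^ 2) := Real.log_nonneg (by nlinarith)
  set A := 2 * Real.log (1024 * K ^ 2) + 1 with hA
  have hA1 : 1 ≤ A := by linarith
  refine ⟨2 ^ 29 * K ^ 2 * A ^ 4, by positivity, ?_⟩
  intro X _ _ n k p ν a hn hk hp hν ha hiso hcp
  have : Nonempty (Fin p) := ⟨⟨0, hp⟩⟩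
  have hn' : (2 : ℝ) ≤ n := by exact_mod_cast hn
  have hk' : (1 : ℝ) ≤ k := by exact_mod_cast hk
  set s : ℕ := min (16 * k) n with hs
  have hs1 : 1 ≤ s := by omega
  have hs1' : (1 : ℝ) ≤ s := by exact_mod_cast hs1
  have hsk : (s : ℝ) ≤ 16 * k := by exact_mod_cast min_le_left _ _
  have hsn : (s : ℝ) ≤ n := by exact_mod_cast min_le_right _ _
  set S := Real.sqrt s with hS
  have hS0 : 0 < S := Real.sqrt_pos.2 (by linarith)
  have hSs : S ^ 2 = s := Real.sq_sqrt (by linarith)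
  set B := K * S with hB
  have hB0 : 0 < B := mul_pos hK0 hS0
  have hB2 : B ^ 2 = K ^ 2 * s := by rw [hB, mul_pow, hSs]
  have hB2n : B ^ 2 ≤ K ^ 2 * n := by rw [hB2]; gcongr
  set ℓ := Real.log n with hℓ
  have hℓ1 : 1 / 2 ≤ ℓ := by
    have h1 := Real.log_two_gt_d9
    have h2 : Real.log 2 ≤ ℓ := Real.log_le_log (by norm_num) hn'
    linarith
  set Λ := Real.log (1024 * K ^ 2 * n) with hΛ
  have hexpΛ : Real.exp Λ = 1024 * K ^ 2 * n := Real.exp_log (by positivity)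
  have hΛA : Λ ≤ A * ℓ := by
    have : Λ = Real.log (1024 * K ^ 2) + ℓ := Real.log_mul (by positivity) (by positivity)
    rw [this, hA]
    nlinarith
  have hK2n : 2 ≤ K ^ 2 * n := by nlinarith
  have hΛ1 : 1 ≤ Λ := by
    rw [hΛ, Real.le_log_iff_exp_le (by positivity)]
    linarith [Real.exp_one_lt_d9]
  have hl4 : Real.log (4 * n) ≤ Λ := Real.log_le_log (by positivity) (by
    have : (1 : ℝ) ≤ K ^ 2 := one_le_pow₀ hK
    nlinarith)
  have hl40 : 0 ≤ Real.log (4 * n) := Real.log_nonneg (by linarith)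
  set J := ⌈2 * Λ⌉₊ with hJ
  have hJle : (J : ℝ) ≤ 3 * Λ := by
    linarith [(Nat.ceil_lt_add_one (by positivity : 0 ≤ 2 * Λ)).le]
  have hBJ : B / 2 ^ J ≤ 1 / 2 := by
    have h1 : Real.exp Λ ≤ 2 ^ J := by
      have : (2 : ℝ) ^ J = Real.exp (J * Real.log 2) := by
        rw [Real.exp_nat_mul, Real.exp_log (by norm_num)]
      rw [this]
      apply Real.exp_le_exp.2
      have := Nat.le_ceil (2 * Λ)
      nlinarith [Real.log_two_gt_d9]
    rw [div_le_iff₀ (by positivity)]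
    have h2 : B ≤ K ^ 2 * n := by nlinarith
    rw [hexpΛ] at h1
    linarith
  set e : ℕ → ℝ := fun j => 1 / (64 * (((j : ℝ) + 1) * (j + 2))) / (B / 2 ^ (j + 1)) ^ 2 with he
  have heq : ∀ j, e j = 4 ^ (j + 1) / (64 * (((j : ℝ) + 1) * (j + 2)) * B ^ 2) := by
    intro j
    have : (4 : ℝ) ^ (j + 1) = (2 ^ (j + 1)) ^ 2 := by rw [← pow_mul, mul_comm, pow_mul]; norm_num
    rw [this, he]
    field_simp
  set N : ℕ → ℕ := fun j => ⌈4096 * 4 ^ (j + 1) * Λ⌉₊ with hN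
  have hfail : ∀ j ∈ Finset.range J, unifProb (fun ω : Fin p → X => ¬ ∀ h : Fin n → ℂ,
      norm1C h ≤ S → unifProb (fun x => B / 2 ^ (j + 1) ≤ ‖∑ t, a x t * h t‖) / 2 - e j ≤
        unifProb (fun i => B / 2 ^ (j + 1) / 2 ≤ ‖∑ t, a (ω i) t * h t‖)) ≤
      Real.exp (-ν) * Real.exp (-J) := by
    intro j hj
    have hjJ : (j : ℝ) + 1 ≤ J := by exact_mod_cast Finset.mem_range.1 hj
    have hQ1 : (1 : ℝ) ≤ 4 ^ (j + 1) := one_le_pow₀ (by norm_num)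
    have hNge : 4096 * 4 ^ (j + 1) * Λ ≤ (N j : ℝ) := Nat.le_ceil _
    have hNpos : 0 < N j := Nat.ceil_pos.2 (by positivity)
    refine (unifProb_level_fails_le (by omega) hNpos hp hK0 hS0 ha (by positivity)
      (div_le_self hB0.le (one_le_pow₀ (by norm_num))) (e := e j) ?_).trans ?_
    · have h1 : Λ ≤ N j * ((B / 2 ^ (j + 1)) ^ 2 / (4096 * B ^ 2)) := by
        have : (4 : ℝ) ^ (j + 1) = (2 ^ (j + 1)) ^ 2 := by
          rw [← pow_mul, mul_comm, pow_mul]; norm_num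
        have h2 : (N j : ℝ) * ((B / 2 ^ (j + 1)) ^ 2 / (4096 * B ^ 2)) =
            N j / (4096 * 4 ^ (j + 1)) := by
          rw [this]; field_simp
        rw [h2, le_div_iff₀ (by positivity)]
        linarith
      have h3 : Real.exp (-(N j * ((B / 2 ^ (j + 1)) ^ 2 / (4096 * B ^ 2)))) ≤
          1 / (1024 * K ^ 2 * n) := by
        rw [one_div, ← hexpΛ, ← Real.exp_neg]
        exact Real.exp_le_exp.2 (by linarith)
      calc _ ≤ 16 * (1 / (1024 * K ^ 2 * n)) := by linarith
        _ = 1 / (64 * (K ^ 2 * n)) := by field_simp; norm_num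
        _ ≤ e j := by
          rw [heq, div_le_div_iff₀ (by positivity) (by positivity)]
          have h5 := mul_le_mul (mul_succ_le_four_pow j) hB2n (by positivity) (by positivity)
          linarith
    · have hexp : (4 * (n : ℝ)) ^ N j = Real.exp (N j * Real.log (4 * n)) := by
        rw [Real.exp_nat_mul, Real.exp_log (by positivity)]
      rw [hexp, ← Real.exp_add, ← Real.exp_add]
      apply Real.exp_le_exp.2
      have hJ1 : (J : ℝ) + 1 ≤ 4 * Λ := by linarith
      have := entropy_le_exponent (Λ := Λ) (Q := 4 ^ (j + 1)) (m := ((j : ℝ) + 1) * (j + 2))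
        (N := N j) (l := Real.log (4 * n)) (J := J) (b := B ^ 2) (ν := ν) (p := p) hΛ1 hQ1
        (by positivity) (mul_succ_le_four_pow j)
        (by
          calc ((j : ℝ) + 1) * (j + 2) ≤ (4 * Λ) * (4 * Λ) :=
                mul_le_mul (by linarith) (by linarith) (by positivity) (by positivity)
            _ = _ := by ring)
        (Nat.ceil_lt_add_one (by positivity)).le hl40 hl4 (by positivity) hJle (by positivity)
        hν.le (by
          have h1 : Λ ^ 4 ≤ A ^ 4 * ℓ ^ 4 := by
            rw [← mul_pow]; exact pow_le_pow_left₀ (by linarith) hΛA 4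
          have hA4 : 1 ≤ A ^ 4 := one_le_pow₀ hA1
          have h2 : 2 ^ 18 * Λ ^ 4 + ν ≤ 2 ^ 18 * A ^ 4 * (ℓ ^ 4 + ν) := by nlinarith
          calc 128 * B ^ 2 * (2 ^ 18 * Λ ^ 4 + ν) ≤
                128 * (K ^ 2 * (16 * k)) * (2 ^ 18 * A ^ 4 * (ℓ ^ 4 + ν)) := by
                rw [hB2]; gcongr
            _ = 2 ^ 29 * K ^ 2 * A ^ 4 * k * (ℓ ^ 4 + ν) := by ring
            _ ≤ p := hcp)
      rw [← heq] at this
      linarith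
  have hbad : unifProb (fun ω : Fin p → X => ¬ ∀ h : Fin n → ℂ,
      norm1C h ≤ 4 * Real.sqrt k * norm2C h →
        1 / 100 * norm2C h ^ 2 ≤ (∑ i, ‖∑ t, a (ω i) t * h t‖ ^ 2) / p) ≤ Real.exp (-ν) := by
    calc _ ≤ unifProb (fun ω : Fin p → X => ∃ j ∈ Finset.range J, ¬ ∀ h : Fin n → ℂ,
          norm1C h ≤ S → unifProb (fun x => B / 2 ^ (j + 1) ≤ ‖∑ t, a x t * h t‖) / 2 - e j ≤
            unifProb (fun i => B / 2 ^ (j + 1) / 2 ≤ ‖∑ t, a (ω i) t * h t‖)) := by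
          refine unifProb_mono fun ω hω => ?_
          by_contra hcon
          push Not at hcon
          refine hω fun h hh => ?_
          have hhS : norm1C h ≤ S * norm2C h := by
            rcases le_total (16 * k) n with hle | hle
            · have : S = 4 * Real.sqrt k := by
                rw [hS, hs, min_eq_left hle]; push_cast
                rw [Real.sqrt_mul (by norm_num), show (16 : ℝ) = 4 ^ 2 by norm_num,
                  Real.sqrt_sq (by norm_num)]
              rw [this]; exact hh
            · have : S = Real.sqrt n := by rw [hS, hs, min_eq_right hle]
              rw [this]; exact norm1C_le_sqrt_mul_norm2C h
          refine lower_bound_of_levels hp hK0 hS0 ha hiso hBJ ?_ hcon hhS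
          refine le_trans (le_of_eq (Finset.sum_congr rfl fun j _ => ?_)) (sum_inv_mul_succ_le J)
          rw [he, ← hB]
          field_simp
      _ ≤ ∑ j ∈ Finset.range J, Real.exp (-ν) * Real.exp (-J) :=
          (unifProb_exists_le _ _).trans (Finset.sum_le_sum hfail)
      _ = Real.exp (-ν) * (J * Real.exp (-J)) := by simp; ring
      _ ≤ Real.exp (-ν) * 1 := by
          gcongr
          rw [Real.exp_neg, ← div_eq_mul_inv, div_le_one (Real.exp_pos _)]
          linarith [Real.add_one_le_exp (J : ℝ)]
      _ = _ := mul_one _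
  rw [unifProb_not] at hbad
  linarith

end RestrictedLowerBound

/-! ### The rows of the condensed measurement matrix -/

section Rows

theorem betaVec_eq_pow (β : ℝ) (lam : ℕ) (j : Fin lam) :
    betaVec β lam j = β⁻¹ ^ ((j : ℕ) + 1) := by
  rw [betaVec, show (-((j : ℕ) : ℤ) - 1) = -(((j : ℕ) + 1 : ℕ) : ℤ) by push_cast; ring, zpow_neg,
    zpow_natCast, inv_pow]

theorem betaVec_pos {β : ℝ} (hβ : 1 < β) (lam : ℕ) (j : Fin lam) : 0 < betaVec β lam j := by
  rw [betaVec_eq_pow]; positivity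

theorem sum_betaVec_le {β : ℝ} (hβ : 1 < β) (lam : ℕ) :
    ∑ j, betaVec β lam j ≤ 1 / (β - 1) := by
  have hβ1 : 0 < β - 1 := by linarith
  have key : ∀ L : ℕ, ∑ j ∈ Finset.range L, β⁻¹ ^ (j + 1) = 1 / (β - 1) * (1 - β⁻¹ ^ L) := by
    intro L
    induction L with
    | zero => simp
    | succ L ih =>
      rw [Finset.sum_range_succ, ih, pow_succ]
      field_simp
      ring
  simp only [betaVec_eq_pow]
  rw [Fin.sum_univ_eq_sum_range (fun j => β⁻¹ ^ (j + 1)), key]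
  have : 0 < β⁻¹ ^ lam := by positivity
  have h2 : 0 < 1 / (β - 1) := by positivity
  nlinarith

theorem inv_le_norm2_betaVec (β : ℝ) {lam : ℕ} (hlam : 0 < lam) :
    β⁻¹ ≤ norm2 (betaVec β lam) := by
  refine Real.le_sqrt_of_sq_le ?_
  have := Finset.single_le_sum (f := fun j => betaVec β lam j ^ 2) (s := Finset.univ)
    (fun j _ => sq_nonneg _) (Finset.mem_univ (⟨0, hlam⟩ : Fin lam))
  simpa [betaVec_eq_pow] using this

/-- A row of `√p V̂_β Φ`, as a function of one block of indices and signs. -/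
def condensedRow {n lam : ℕ} (β : ℝ) (U : Matrix (Fin n) (Fin n) ℂ)
    (x : (Fin lam → Fin n) × (Fin lam → Bool)) (t : Fin n) : ℂ :=
  ∑ l, ((betaVec β lam l / norm2 (betaVec β lam) : ℝ) : ℂ) *
    (((rsign (x.2 l) : ℝ) : ℂ) * U (x.1 l) t)

theorem norm_rsign (b : Bool) : ‖((rsign b : ℝ) : ℂ)‖ = 1 := by
  cases b <;> simp [rsign]

theorem norm_condensedRow_le {n lam : ℕ} {β : ℝ} (hβ : 1 < β) (hlam : 0 < lam)
    {U : Matrix (Fin n) (Fin n) ℂ} (hU : ∀ i j, ‖U i j‖ ≤ 1)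
    (x : (Fin lam → Fin n) × (Fin lam → Bool)) (t : Fin n) :
    ‖condensedRow β U x t‖ ≤ β / (β - 1) := by
  have hβ0 : 0 < β := by linarith
  have hβ1 : 0 < β - 1 := by linarith
  have hv := inv_le_norm2_betaVec β hlam
  have hv0 : 0 < norm2 (betaVec β lam) := (inv_pos.2 hβ0).trans_le hv
  calc _ ≤ ∑ l, betaVec β lam l / norm2 (betaVec β lam) := by
        refine (norm_sum_le _ _).trans (Finset.sum_le_sum fun l _ => ?_)
        have hpos := div_pos (betaVec_pos hβ lam l) hv0
        rw [norm_mul, norm_mul, norm_rsign, one_mul, Complex.norm_real, Real.norm_eq_abs,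
          abs_of_pos hpos]
        exact mul_le_of_le_one_right hpos.le (hU _ _)
    _ ≤ (1 / (β - 1)) / norm2 (betaVec β lam) := by
        rw [← Finset.sum_div]
        gcongr
        exact sum_betaVec_le hβ lam
    _ ≤ (1 / (β - 1)) / β⁻¹ := by gcongr
    _ = _ := by field_simp

/-- Orthogonality of Rademacher signs. -/
theorem sum_signs_norm_sq {L : ℕ} (c : Fin L → ℂ) (z : ℂ) :
    ∑ ε : Fin L → Bool, ‖z + ∑ l, ((rsign (ε l) : ℝ) : ℂ) * c l‖ ^ 2 =
      2 ^ L * (‖z‖ ^ 2 + ∑ l, ‖c l‖ ^ 2) := by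
  induction L generalizing z with
  | zero => simp
  | succ L ih =>
    rw [← (Fin.consEquiv (fun _ : Fin (L + 1) => Bool)).sum_comp, Fintype.sum_prod_type]
    simp only [Fin.consEquiv_apply, Fin.sum_univ_succ, Fin.cons_zero, Fin.cons_succ, ← add_assoc,
      ih (fun l => c l.succ), Fintype.sum_bool]
    have := parallelogram_law_with_norm ℝ z (c 0)
    simp only [rsign, if_true, Bool.false_eq_true, if_false, Complex.ofReal_one, one_mul,
      Complex.ofReal_neg, neg_one_mul, ← sub_eq_add_neg, pow_succ]
    linear_combination 2 ^ L * this

theorem sum_coordinate_div {L : ℕ} {Y : Type*} [Fintype Y] [Nonempty Y] (φ : Y → ℝ) (l : Fin L) :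
    (∑ i : Fin L → Y, φ (i l)) / Fintype.card (Fin L → Y) = (∑ y, φ y) / Fintype.card Y := by
  classical
  have hcard := Fintype.card_congr (Equiv.funSplitAt l Y)
  rw [Fintype.card_prod] at hcard
  have hsum : ∑ i : Fin L → Y, φ (i l) =
      Fintype.card ({j // j ≠ l} → Y) * ∑ y, φ y := by
    rw [← (Equiv.funSplitAt l Y).symm.sum_comp, Fintype.sum_prod_type]
    simp [Equiv.funSplitAt, Equiv.piSplitAt, Finset.mul_sum]
  rw [hsum, hcard]
  have h1 : (Fintype.card Y : ℝ) ≠ 0 := by exact_mod_cast Fintype.card_ne_zero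
  have h2 : (Fintype.card ({j // j ≠ l} → Y) : ℝ) ≠ 0 := by exact_mod_cast Fintype.card_ne_zero
  push_cast
  rw [mul_comm (Fintype.card Y : ℝ), mul_div_mul_left _ _ h2]

theorem sum_norm_mulVec_sq {n : ℕ} {U : Matrix (Fin n) (Fin n) ℂ}
    (hU : Uᴴ * U = (n : ℂ) • (1 : Matrix (Fin n) (Fin n) ℂ)) (h : Fin n → ℂ) :
    ∑ i, ‖∑ t, U i t * h t‖ ^ 2 = n * ∑ t, ‖h t‖ ^ 2 := by
  have hself : ∀ z : Fin n → ℂ, star z ⬝ᵥ z = ((∑ t, ‖z t‖ ^ 2 : ℝ) : ℂ) := by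
    intro z
    simp [dotProduct, Complex.conj_mul']
  have h1 : star (U *ᵥ h) ⬝ᵥ (U *ᵥ h) = (n : ℂ) * (star h ⬝ᵥ h) := by
    rw [Matrix.star_mulVec, Matrix.dotProduct_mulVec, Matrix.vecMul_vecMul, hU,
      ← Matrix.dotProduct_mulVec, Matrix.smul_mulVec, Matrix.one_mulVec, dotProduct_smul,
      smul_eq_mul]
  rw [hself, hself] at h1
  have h2 : (∑ i, ‖(U *ᵥ h) i‖ ^ 2 : ℝ) = n * ∑ t, ‖h t‖ ^ 2 := by exact_mod_cast h1
  exact h2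

theorem condensedRow_isotropic {n lam : ℕ} {β : ℝ} (hβ : 1 < β) (hlam : 0 < lam) (hn : 0 < n)
    {U : Matrix (Fin n) (Fin n) ℂ} (hU : Uᴴ * U = (n : ℂ) • (1 : Matrix (Fin n) (Fin n) ℂ))
    (h : Fin n → ℂ) :
    (∑ x : (Fin lam → Fin n) × (Fin lam → Bool), ‖∑ t, condensedRow β U x t * h t‖ ^ 2) /
      Fintype.card ((Fin lam → Fin n) × (Fin lam → Bool)) = ∑ t, ‖h t‖ ^ 2 := by
  have : Nonempty (Fin n) := ⟨⟨0, hn⟩⟩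
  have hn0 : (n : ℝ) ≠ 0 := by exact_mod_cast hn.ne'
  have hβ0 : 0 < β := by linarith
  have hv0 : 0 < norm2 (betaVec β lam) :=
    (inv_pos.2 hβ0).trans_le (inv_le_norm2_betaVec β hlam)
  set w : Fin lam → ℝ := fun l => betaVec β lam l / norm2 (betaVec β lam) with hw
  have hw1 : ∑ l, w l ^ 2 = 1 := by
    have hsq : norm2 (betaVec β lam) ^ 2 = ∑ l, betaVec β lam l ^ 2 :=
      Real.sq_sqrt (Finset.sum_nonneg fun _ _ => sq_nonneg _)
    simp only [hw, div_pow]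
    rw [← Finset.sum_div, ← hsq, div_self (by positivity)]
  set y : Fin n → ℂ := fun i => ∑ t, U i t * h t with hy
  have hrow : ∀ (i : Fin lam → Fin n) (ε : Fin lam → Bool),
      ∑ t, condensedRow β U (i, ε) t * h t =
        0 + ∑ l, ((rsign (ε l) : ℝ) : ℂ) * ((w l : ℂ) * y (i l)) := by
    intro i ε
    simp only [condensedRow, Finset.sum_mul, zero_add, hy, Finset.mul_sum]
    rw [Finset.sum_comm]
    refine Finset.sum_congr rfl fun l _ => Finset.sum_congr rfl fun t _ => ?_
    rw [hw]
    ring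
  rw [Fintype.sum_prod_type]
  simp only [hrow, sum_signs_norm_sq]
  simp only [norm_zero, norm_mul, mul_pow, Complex.norm_real, Real.norm_eq_abs, sq_abs]
  rw [← Finset.mul_sum, Fintype.card_prod, Fintype.card_fun (α := Fin lam) (β := Bool)]
  simp only [Fintype.card_bool, Fintype.card_fin]
  push_cast
  rw [mul_comm (Fintype.card (Fin lam → Fin n) : ℝ), mul_div_mul_left _ _ (by positivity)]
  simp only [ne_eq, OfNat.ofNat_ne_zero, not_false_eq_true, zero_pow, zero_add]
  rw [Finset.sum_comm, Finset.sum_div]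
  have hcol : ∀ l : Fin lam, (∑ i : Fin lam → Fin n, w l ^ 2 * ‖y (i l)‖ ^ 2) /
      (Fintype.card (Fin lam → Fin n) : ℝ) = w l ^ 2 * ∑ t, ‖h t‖ ^ 2 := by
    intro l
    rw [← Finset.mul_sum, mul_div_assoc, sum_coordinate_div (fun i => ‖y i‖ ^ 2) l,
      sum_norm_mulVec_sq hU, Fintype.card_fin]
    field_simp
  simp only [hcol]
  rw [← Finset.sum_mul, hw1, one_mul]

end Rows

/-! ### Block structure of the condensation and noise transfer operators -/

section Blocks

theorem kronRow_map_mulVec {p lam : ℕ} (r : ℝ) (v : Fin lam → ℝ) (y : Fin (p * lam) → ℂ)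
    (i : Fin p) :
    (((r • kronRow p v).map Complex.ofReal).mulVec y) i =
      (r : ℂ) * ∑ l, (v l : ℂ) * y (finProdFinEquiv (i, l)) := by
  rw [Matrix.mulVec, dotProduct, ← finProdFinEquiv.sum_comp, Fintype.sum_prod_type,
    Finset.sum_eq_single i]
  · rw [Finset.mul_sum]
    refine Finset.sum_congr rfl fun l _ => ?_
    have hl : 0 < lam := l.pos
    simp [kronRow, finProdFinEquiv, Nat.add_mul_div_left _ _ hl, Nat.div_eq_of_lt l.2,
      Nat.mod_eq_of_lt l.2, mul_assoc]
  · intro i' _ hne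
    refine Finset.sum_eq_zero fun l _ => ?_
    have hl : 0 < lam := l.pos
    have : (i' : ℕ) ≠ i := fun h => hne (Fin.ext h)
    simp [kronRow, finProdFinEquiv, Nat.add_mul_div_left _ _ hl, Nat.div_eq_of_lt l.2, this]
  · simp

theorem kronDiag_map_mulVec {p lam : ℕ} (B : Matrix (Fin lam) (Fin lam) ℝ)
    (u : Fin (p * lam) → ℂ) (i : Fin p) (l : Fin lam) :
    (((kronDiag p B).map Complex.ofReal).mulVec u) (finProdFinEquiv (i, l)) =
      ∑ m, (B l m : ℂ) * u (finProdFinEquiv (i, m)) := by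
  have hl : 0 < lam := l.pos
  rw [Matrix.mulVec, dotProduct, ← finProdFinEquiv.sum_comp, Fintype.sum_prod_type,
    Finset.sum_eq_single i]
  · refine Finset.sum_congr rfl fun m _ => ?_
    simp [kronDiag, finProdFinEquiv, Nat.add_mul_div_left _ _ hl, Nat.div_eq_of_lt l.2,
      Nat.div_eq_of_lt m.2, Nat.mod_eq_of_lt l.2, Nat.mod_eq_of_lt m.2]
  · intro i' _ hne
    refine Finset.sum_eq_zero fun m _ => ?_
    have : (i : ℕ) ≠ i' := fun h => hne (Fin.ext h.symm)
    simp [kronDiag, finProdFinEquiv, Nat.add_mul_div_left _ _ hl, Nat.div_eq_of_lt l.2,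
      Nat.div_eq_of_lt m.2, this]
  · simp

/-- `v_β H_β = (0, …, 0, β ^ (-λ))`. -/
theorem betaVec_vecMul_betaH {β : ℝ} (hβ : β ≠ 0) {lam : ℕ} (m : Fin lam) :
    ∑ l, betaVec β lam l * betaH β lam l m =
      if (m : ℕ) + 1 = lam then β⁻¹ ^ lam else 0 := by
  have hsplit : ∀ l : Fin lam, betaVec β lam l * betaH β lam l m =
      (if l = m then betaVec β lam l else 0) -
        (if (l : ℕ) = m + 1 then β * betaVec β lam l else 0) := by
    intro l
    by_cases h1 : l = m
    · subst h1; simp [betaH]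
    · have h1' : (l : ℕ) ≠ m := fun h => h1 (Fin.ext h)
      by_cases h2 : (l : ℕ) = m + 1
      · simp [betaH, h1, h2, mul_comm]
      · simp [betaH, h1, h1', h2]
  simp only [hsplit]
  rw [Finset.sum_sub_distrib, Finset.sum_ite_eq' Finset.univ m, if_pos (Finset.mem_univ _)]
  by_cases hm : (m : ℕ) + 1 = lam
  · rw [if_pos hm, Finset.sum_eq_zero, sub_zero, betaVec_eq_pow, hm]
    intro l _
    rw [if_neg]
    have := l.2
    omega
  · have hlt : (m : ℕ) + 1 < lam := by have := m.2; omega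
    rw [if_neg hm, Finset.sum_eq_single ⟨(m : ℕ) + 1, hlt⟩]
    · simp only [betaVec_eq_pow, if_true]
      rw [pow_succ _ ((m : ℕ) + 1)]
      field_simp
      simp
    · intro l _ hne
      rw [if_neg]
      exact fun h => hne (Fin.ext h)
    · simp

theorem norm_le_normInfC {n : ℕ} (u : Fin n → ℂ) (j : Fin n) : ‖u j‖ ≤ normInfC u :=
  le_ciSup (f := fun j => ‖u j‖) (Set.finite_range _).bddAbove j

theorem norm_sum_betaVec_betaH_le {β δ : ℝ} (hβ : 1 < β) {lam : ℕ} (hlam : 0 < lam)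
    (u : Fin lam → ℂ) (hu : ∀ m, ‖u m‖ ≤ δ) :
    ‖∑ l, (betaVec β lam l : ℂ) * ∑ m, (betaH β lam l m : ℂ) * u m‖ ≤ β⁻¹ ^ lam * δ := by
  have hβ0 : 0 < β := by linarith
  have hswap : ∑ l, (betaVec β lam l : ℂ) * ∑ m, (betaH β lam l m : ℂ) * u m =
      ∑ m, ((∑ l, betaVec β lam l * betaH β lam l m : ℝ) : ℂ) * u m := by
    push_cast
    simp only [Finset.mul_sum, Finset.sum_mul]
    rw [Finset.sum_comm]
    exact Finset.sum_congr rfl fun m _ => Finset.sum_congr rfl fun l _ => by ring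
  have hlast : (lam - 1) + 1 = lam := by omega
  rw [hswap, Finset.sum_eq_single ⟨lam - 1, by omega⟩]
  · rw [betaVec_vecMul_betaH hβ0.ne', if_pos hlast, norm_mul, Complex.norm_real,
      Real.norm_of_nonneg (by positivity)]
    exact mul_le_mul_of_nonneg_left (hu _) (by positivity)
  · intro m _ hne
    rw [betaVec_vecMul_betaH hβ0.ne', if_neg]
    · simp
    · intro h
      apply hne
      ext
      simp only
      omega
  · simp

end Blocks

/-! ### Recovery by `ℓ¹` minimization -/

section Recovery

theorem norm2C_eq_norm {n : ℕ} (y : Fin n → ℂ) : norm2C y = ‖WithLp.toLp 2 y‖ := by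
  rw [EuclideanSpace.norm_eq]; rfl

theorem norm2C_sub_le {n : ℕ} (y z : Fin n → ℂ) : norm2C (y - z) ≤ norm2C y + norm2C z := by
  simp only [norm2C_eq_norm, WithLp.toLp_sub]
  exact norm_sub_le _ _

theorem norm1C_error_le_of_support {n k : ℕ} {x w : Fin n → ℝ} {xh : Fin n → ℂ}
    (hle : norm1C xh ≤ norm1C fun t => (x t : ℂ)) {s : Finset (Fin n)} (hs : s.card ≤ k)
    (hw : ∀ t ∉ s, w t = 0) :
    norm1C (xh - fun t => (x t : ℂ)) ≤
      2 * Real.sqrt k * norm2C (xh - fun t => (x t : ℂ)) + 2 * norm1 (x - w) := by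
  set h : Fin n → ℂ := xh - fun t => (x t : ℂ) with hh
  have hon : ∑ t ∈ s, ‖h t‖ ≤ Real.sqrt k * norm2C h := by
    rw [norm2C, ← Real.sqrt_mul (by positivity)]
    refine Real.le_sqrt_of_sq_le ?_
    calc (∑ t ∈ s, ‖h t‖) ^ 2 ≤ s.card * ∑ t ∈ s, ‖h t‖ ^ 2 := sq_sum_le_card_mul_sum_sq
      _ ≤ k * ∑ t, ‖h t‖ ^ 2 := by
          gcongr
          exact Finset.subset_univ s
  have hpt : ∀ t, ‖h t‖ - 2 * |(x - w) t| - (‖xh t‖ - ‖(x t : ℂ)‖) ≤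
      if t ∈ s then 2 * ‖h t‖ else 0 := by
    intro t
    have hxt : h t = xh t - (x t : ℂ) := rfl
    have habs := abs_nonneg ((x - w) t)
    split_ifs with ht
    · have := norm_sub_norm_le (x t : ℂ) (xh t)
      rw [norm_sub_rev, ← hxt] at this
      linarith
    · have h1 : |(x - w) t| = ‖(x t : ℂ)‖ := by simp [hw t ht]
      have h2 := norm_sub_le (xh t) (x t : ℂ)
      rw [← hxt] at h2
      linarith
  have hsum := Finset.sum_le_sum fun t (_ : t ∈ Finset.univ) => hpt t
  rw [Finset.sum_sub_distrib, Finset.sum_sub_distrib, Finset.sum_sub_distrib, ← Finset.mul_sum,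
    Finset.sum_ite_mem, Finset.univ_inter, ← Finset.mul_sum] at hsum
  have e1 : norm1C h = ∑ t, ‖h t‖ := rfl
  have e2 : norm1 (x - w) = ∑ t, |(x - w) t| := rfl
  have e3 : norm1C xh = ∑ t, ‖xh t‖ := rfl
  have e4 : norm1C (fun t => (x t : ℂ)) = ∑ t, ‖(x t : ℂ)‖ := rfl
  rw [← e1, ← e2, ← e3, ← e4] at hsum
  linarith

theorem norm1C_error_le {n : ℕ} (k : ℕ) {x : Fin n → ℝ} {xh : Fin n → ℂ}
    (hle : norm1C xh ≤ norm1C fun t => (x t : ℂ)) :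
    norm1C (xh - fun t => (x t : ℂ)) ≤
      2 * Real.sqrt k * norm2C (xh - fun t => (x t : ℂ)) + 2 * sigmaK k x := by
  have : (norm1C (xh - fun t => (x t : ℂ)) -
      2 * Real.sqrt k * norm2C (xh - fun t => (x t : ℂ))) / 2 ≤ sigmaK k x := by
    refine le_csInf ⟨norm1 (x - 0), 0, ⟨∅, by simp, by simp⟩, rfl⟩ ?_
    rintro c ⟨w, ⟨s, hs, hw⟩, rfl⟩
    linarith [norm1C_error_le_of_support hle hs hw]
  linarith

/-- A lower bound on the cone of effectively sparse vectors implies stable recovery. -/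
theorem recovery_of_lower_bound {n k p : ℕ} (hk : 0 < k) {η : ℝ} {x : Fin n → ℝ} {xh : Fin n → ℂ}
    (M : (Fin n → ℂ) → Fin p → ℂ)
    (hM : ∀ h, norm1C h ≤ 4 * Real.sqrt k * norm2C h →
      1 / 100 * norm2C h ^ 2 ≤ norm2C (M h) ^ 2)
    (hle : norm1C xh ≤ norm1C fun t => (x t : ℂ))
    (hη : norm2C (M (xh - fun t => (x t : ℂ))) ≤ 2 * η) :
    norm2C (xh - fun t => (x t : ℂ)) ≤ 20 * η + 1 * sigmaK k x / Real.sqrt k := by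
  set h : Fin n → ℂ := xh - fun t => (x t : ℂ) with hh
  have hsk : 0 < Real.sqrt k := Real.sqrt_pos.2 (by exact_mod_cast hk)
  have hη0 : 0 ≤ η := by linarith [norm2C_nonneg (M h)]
  have hcone := norm1C_error_le k hle
  rw [← hh] at hcone
  have hσ : 0 ≤ sigmaK k x := by
    refine Real.sInf_nonneg ?_
    rintro c ⟨w, -, rfl⟩
    exact Finset.sum_nonneg fun _ _ => abs_nonneg _
  rcases le_total (sigmaK k x) (Real.sqrt k * norm2C h) with hc | hc
  · have h1 := hM h (by linarith)
    have h2 : norm2C (M h) ^ 2 ≤ (2 * η) ^ 2 := pow_le_pow_left₀ (norm2C_nonneg _) hη 2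
    have h3 : norm2C h ≤ 20 * η := by
      refine le_of_sq_le_sq ?_ (by positivity)
      nlinarith
    have : 0 ≤ 1 * sigmaK k x / Real.sqrt k := by positivity
    linarith
  · have : norm2C h ≤ 1 * sigmaK k x / Real.sqrt k := by
      rw [one_mul, le_div_iff₀ hsk]; linarith
    linarith

end Recovery


/-! ### Assembling the measurement blocks -/

section Assembly

/-- Splitting the draws of `p * lam` rows into `p` blocks of length `lam`. -/
def blockEquiv (p lam : ℕ) (A B : Type*) :
    (Fin (p * lam) → A) × (Fin (p * lam) → B) ≃ (Fin p → (Fin lam → A) × (Fin lam → B)) where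
  toFun ω i := (fun l => ω.1 (finProdFinEquiv (i, l)), fun l => ω.2 (finProdFinEquiv (i, l)))
  invFun θ := (fun j => (θ (finProdFinEquiv.symm j).1).1 (finProdFinEquiv.symm j).2,
    fun j => (θ (finProdFinEquiv.symm j).1).2 (finProdFinEquiv.symm j).2)
  left_inv ω := by
    ext j
    · exact congrArg ω.1 (finProdFinEquiv.apply_symm_apply j)
    · exact congrArg ω.2 (finProdFinEquiv.apply_symm_apply j)
  right_inv θ := by
    funext i
    simp only [Equiv.symm_apply_apply]

/-- The entries of `V̂_β Φ h` are inner products with the condensed rows. -/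
theorem condensed_mulVec {n p lam : ℕ} (β : ℝ) (U : Matrix (Fin n) (Fin n) ℂ)
    (ω : (Fin (p * lam) → Fin n) × (Fin (p * lam) → Bool)) (h : Fin n → ℂ) (i : Fin p) :
    (((1 / (norm2 (betaVec β lam) * Real.sqrt p)) •
        kronRow p (betaVec β lam)).map Complex.ofReal).mulVec
      ((Matrix.of fun j t => ((rsign (ω.2 j) : ℝ) : ℂ) * U (ω.1 j) t).mulVec h) i =
      ((1 / Real.sqrt p : ℝ) : ℂ) *
        ∑ t, condensedRow β U (blockEquiv p lam (Fin n) Bool ω i) t * h t := by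
  rw [kronRow_map_mulVec]
  simp only [condensedRow, blockEquiv, Equiv.coe_fn_mk, Matrix.mulVec, dotProduct, Matrix.of_apply,
    Finset.sum_mul, Finset.mul_sum]
  rw [Finset.sum_comm]
  refine Finset.sum_congr rfl fun t _ => Finset.sum_congr rfl fun l _ => ?_
  push_cast
  rw [one_div, mul_inv, one_div]
  ring

theorem norm2C_sq_inv_sqrt_mul {p : ℕ} (y : Fin p → ℂ) :
    norm2C (fun i => ((1 / Real.sqrt p : ℝ) : ℂ) * y i) ^ 2 = (∑ i, ‖y i‖ ^ 2) / p := by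
  rw [norm2C_sq, Finset.sum_div]
  refine Finset.sum_congr rfl fun i _ => ?_
  rw [norm_mul, mul_pow, Complex.norm_real, Real.norm_eq_abs, sq_abs, div_pow, one_pow,
    Real.sq_sqrt (Nat.cast_nonneg p)]
  ring

/-- The condensation operator shrinks the shaped noise to size `δ β ^ (-λ + 1)`. -/
theorem norm2C_condensed_noise_le {β δ : ℝ} (hβ : 1 < β) (hδ : 0 < δ) {p lam : ℕ}
    (hp : 0 < p) (hlam : 0 < lam) {u : Fin (p * lam) → ℂ} (hu : normInfC u ≤ δ) :
    norm2C ((((1 / (norm2 (betaVec β lam) * Real.sqrt p)) •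
        kronRow p (betaVec β lam)).map Complex.ofReal).mulVec
      (((kronDiag p (betaH β lam)).map Complex.ofReal).mulVec u)) ≤
      δ * β ^ (-(lam : ℤ) + 1) := by
  have hβ0 : 0 < β := by linarith
  have hv := inv_le_norm2_betaVec β hlam
  have hv0 : 0 < norm2 (betaVec β lam) := (inv_pos.2 hβ0).trans_le hv
  have hp0 : (0 : ℝ) < p := by exact_mod_cast hp
  have hη : δ * β ^ (-(lam : ℤ) + 1) = β⁻¹ ^ lam * δ / β⁻¹ := by
    rw [zpow_add₀ hβ0.ne', zpow_neg, zpow_natCast, zpow_one, inv_pow, div_inv_eq_mul]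
    ring
  have hentry : ∀ i, ‖(((1 / (norm2 (betaVec β lam) * Real.sqrt p)) •
        kronRow p (betaVec β lam)).map Complex.ofReal).mulVec
      (((kronDiag p (betaH β lam)).map Complex.ofReal).mulVec u) i‖ ^ 2 ≤
      (δ * β ^ (-(lam : ℤ) + 1)) ^ 2 / p := by
    intro i
    rw [kronRow_map_mulVec, norm_mul, Complex.norm_real, Real.norm_of_nonneg (by positivity)]
    simp only [kronDiag_map_mulVec]
    have h1 := norm_sum_betaVec_betaH_le hβ hlam (fun m => u (finProdFinEquiv (i, m)))
      fun m => (norm_le_normInfC u _).trans hu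
    calc _ ≤ (1 / (norm2 (betaVec β lam) * Real.sqrt p) * (β⁻¹ ^ lam * δ)) ^ 2 := by gcongr
      _ = (β⁻¹ ^ lam * δ / norm2 (betaVec β lam)) ^ 2 / Real.sqrt p ^ 2 := by
          field_simp
      _ ≤ _ := by
          rw [hη, Real.sq_sqrt hp0.le]
          gcongr
  refine Real.sqrt_le_iff.2 ⟨by positivity, ?_⟩
  refine (Finset.sum_le_sum fun i _ => hentry i).trans_eq ?_
  rw [Finset.sum_const, Finset.card_univ, Fintype.card_fin, nsmul_eq_mul]
  field_simp

end Assembly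

/-- recovery guarantee for distributed noise-shaping quantized compressed
sensing measurements from a sign-randomized bounded orthogonal ensemble, via the
constrained `ℓ¹`-minimization program with the condensation operator `V̂_β`. -/
theorem stmt11 (β : ℝ) (hβ : 1 < β) :
    ∃ c C D : ℝ, 0 < c ∧ 0 < C ∧ 0 < D ∧
      ∀ (lam n k p : ℕ) (δ ν : ℝ) (U : Matrix (Fin n) (Fin n) ℂ),
        0 < lam → 2 ≤ n → 0 < k → 0 < p → 0 < δ → 0 < ν →
        Uᴴ * U = (n : ℂ) • (1 : Matrix (Fin n) (Fin n) ℂ) →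
        (∀ i j, ‖U i j‖ ≤ 1) →
        p ≤ p * lam →
        c * (k : ℝ) * ((Real.log n) ^ 4 + ν) ≤ (p : ℝ) →
        unifProb (fun ω : (Fin (p * lam) → Fin n) × (Fin (p * lam) → Bool) =>
            let Φ : Matrix (Fin (p * lam)) (Fin n) ℂ :=
              Matrix.of fun j t => ((rsign (ω.2 j) : ℝ) : ℂ) * U (ω.1 j) t
            let Vh : Matrix (Fin p) (Fin (p * lam)) ℂ :=
              ((1 / (norm2 (betaVec β lam) * Real.sqrt p)) •
                  kronRow p (betaVec β lam)).map Complex.ofReal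
            let Hm : Matrix (Fin (p * lam)) (Fin (p * lam)) ℂ :=
              (kronDiag p (betaH β lam)).map Complex.ofReal
            let η : ℝ := δ * β ^ (-(lam : ℤ) + 1)
            ∀ (x : Fin n → ℝ) (μ : ℝ),
              normInfC (Φ.mulVec fun t => (x t : ℂ)) ≤ μ → μ < 1 →
              ∀ q u : Fin (p * lam) → ℂ,
                (∀ j, Φ.mulVec (fun t => (x t : ℂ)) j - q j = Hm.mulVec u j) →
                normInfC u ≤ δ →
                ∀ xh : Fin n → ℂ,
                  (norm2C (Vh.mulVec (Φ.mulVec xh) - Vh.mulVec q) ≤ η ∧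
                    ∀ z : Fin n → ℂ,
                      norm2C (Vh.mulVec (Φ.mulVec z) - Vh.mulVec q) ≤ η →
                      norm1C xh ≤ norm1C z) →
                  norm2C (xh - fun t => (x t : ℂ))
                    ≤ C * β ^ (-(((p * lam : ℕ) : ℝ) / (p : ℝ)) + 1) * δ
                      + D * sigmaK k x / Real.sqrt k)
          ≥ 1 - Real.exp (-ν) := by
  have hβ1 : 0 < β - 1 := by linarith
  have hK : 1 ≤ β / (β - 1) := by rw [le_div_iff₀ hβ1]; linarith
  obtain ⟨c, hc, hprob⟩ := restricted_lower_bound hK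
  refine ⟨c, 20, 1, hc, by norm_num, by norm_num, ?_⟩
  intro lam n k p δ ν U hlam hn hk hp hδ hν hU hU1 _ hcp
  have hβ0 : 0 < β := by linarith
  have hp0 : (p : ℝ) ≠ 0 := by exact_mod_cast hp.ne'
  have : Nonempty (Fin n) := ⟨⟨0, by omega⟩⟩
  have hrpow : β ^ (-(((p * lam : ℕ) : ℝ) / (p : ℝ)) + 1) = β ^ (-(lam : ℤ) + 1) := by
    rw [← Real.rpow_intCast]
    push_cast
    rw [mul_div_cancel_left₀ _ hp0]
  have hgood := hprob n k p ν (condensedRow (lam := lam) β U) hn hk hp hν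
    (norm_condensedRow_le hβ hlam hU1) (condensedRow_isotropic hβ hlam (by omega) hU) hcp
  rw [← unifProb_congr_equiv (blockEquiv p lam (Fin n) Bool)] at hgood
  refine hgood.trans (unifProb_mono fun ω hω => ?_)
  intro Φ Vh Hm η x μ _ _ q u hq hu xh hxh
  obtain ⟨hfeas, hmin⟩ := hxh
  have hx : norm2C (Vh.mulVec (Φ.mulVec fun t => (x t : ℂ)) - Vh.mulVec q) ≤ η := by
    rw [← Matrix.mulVec_sub, show (Φ.mulVec fun t => (x t : ℂ)) - q = Hm.mulVec u from funext hq]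
    exact norm2C_condensed_noise_le hβ hδ hp hlam hu
  have herr : norm2C (Vh.mulVec (Φ.mulVec (xh - fun t => (x t : ℂ)))) ≤ 2 * η := by
    have h1 := norm2C_sub_le (Vh.mulVec (Φ.mulVec xh) - Vh.mulVec q)
      (Vh.mulVec (Φ.mulVec fun t => (x t : ℂ)) - Vh.mulVec q)
    rw [sub_sub_sub_cancel_right, ← Matrix.mulVec_sub, ← Matrix.mulVec_sub] at h1
    linarith
  have hrec := recovery_of_lower_bound hk (fun h => Vh.mulVec (Φ.mulVec h))
    (fun h hh => by
      rw [show Vh.mulVec (Φ.mulVec h) = _ from funext (condensed_mulVec β U ω h),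
        norm2C_sq_inv_sqrt_mul]
      exact hω h hh) (hmin _ hx) herr
  rw [hrpow, mul_assoc, mul_comm _ δ]
  exact hrec
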